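/- arXiv:1006.0161 — 2 statements merged into one kernel-verified Lean document; each statement's English description precedes it below -/
import Mathlib

section
/- Let V = V₀ ⊔ V₁ be a finite set and A a skew-symmetric integer matrix on V with entries in {−1, 0, 1} and A v w = 0 whenever v, w ∈ V₀ or v, w ∈ V₁ (a bipartite adjacency matrix). For p ∈ V₀, q ∈ V₁ with A p q ≠ 0, the Ω₄-pivot of A at (p, q) is the skew-symmetric matrix à with à p q = −A p q, à i j = A i j whenever exactly one of i, j lies in {p, q}, and à i j = A i j − (A p q)(A i p)(A j q) + (A p q)(A i q)(A j p) for {i, j} ∩ {p, q} = ∅. An odd square of a matrix M consists of distinct i, p ∈ V₀ and distinct j, q ∈ V₁ with all four entries M i j, M i q, M p j, M p q nonzero and M i j · M i q · M p j · M p q = −1. Then A is principally unimodular if and only if every matrix obtained from A by a finite sequence of Ω₄-pivots has all entries in {−1, 0, 1} and contains no odd square. -/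
open Matrix

variable {V₀ V₁ : Type*}

/-- All entries of the matrix lie in `{-1, 0, 1}`. -/
def EntriesUnit (M : Matrix (V₀ ⊕ V₁) (V₀ ⊕ V₁) ℤ) : Prop :=
  ∀ i j, M i j ∈ ({-1, 0, 1} : Set ℤ)

/-- The Ω₄-pivot of a bipartite skew-symmetric matrix at `(p, q) ∈ V₀ × V₁`:
the entry at `{p, q}` is negated, entries involving exactly one of `p, q` are kept, and
`M i j` becomes `M i j - M p q · M i p · M j q + M p q · M i q · M j p` otherwise. -/
def pivotMat [DecidableEq V₀] [DecidableEq V₁]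
    (M : Matrix (V₀ ⊕ V₁) (V₀ ⊕ V₁) ℤ) (p : V₀) (q : V₁) :
    Matrix (V₀ ⊕ V₁) (V₀ ⊕ V₁) ℤ :=
  fun i j =>
    if (i = Sum.inl p ∧ j = Sum.inr q) ∨ (i = Sum.inr q ∧ j = Sum.inl p) then -M i j
    else if i = Sum.inl p ∨ i = Sum.inr q ∨ j = Sum.inl p ∨ j = Sum.inr q then M i j
    else M i j - M (Sum.inl p) (Sum.inr q) * M i (Sum.inl p) * M j (Sum.inr q)
           + M (Sum.inl p) (Sum.inr q) * M i (Sum.inr q) * M j (Sum.inl p)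

/-- One Ω₄-pivot step: a pivot is allowed at any pair `(p, q) ∈ V₀ × V₁` at which the
current matrix has a nonzero entry. -/
def PivotStep [DecidableEq V₀] [DecidableEq V₁]
    (M N : Matrix (V₀ ⊕ V₁) (V₀ ⊕ V₁) ℤ) : Prop :=
  ∃ (p : V₀) (q : V₁), M (Sum.inl p) (Sum.inr q) ≠ 0 ∧ N = pivotMat M p q

/-- An odd square: distinct `i, p ∈ V₀` and distinct `j, q ∈ V₁` with all four
entries nonzero and product `-1`. -/
def HasOddSquare (M : Matrix (V₀ ⊕ V₁) (V₀ ⊕ V₁) ℤ) : Prop :=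
  ∃ (i p : V₀) (j q : V₁), i ≠ p ∧ j ≠ q ∧
    M (Sum.inl i) (Sum.inr j) ≠ 0 ∧ M (Sum.inl i) (Sum.inr q) ≠ 0 ∧
    M (Sum.inl p) (Sum.inr j) ≠ 0 ∧ M (Sum.inl p) (Sum.inr q) ≠ 0 ∧
    M (Sum.inl i) (Sum.inr j) * M (Sum.inl i) (Sum.inr q) *
      M (Sum.inl p) (Sum.inr j) * M (Sum.inl p) (Sum.inr q) = -1

/-- The skew-symmetric matrix of a bipartite graph with biadjacency matrix `B`. -/
def skewBip {m n : Type*} (B : Matrix m n ℤ) : Matrix (m ⊕ n) (m ⊕ n) ℤ :=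
  fromBlocks 0 B (-Bᵀ) 0

/-- The action of an Ω₄-pivot on the biadjacency matrix. -/
def bipPivot {m n : Type*} [DecidableEq m] [DecidableEq n] (B : Matrix m n ℤ) (p : m) (q : n) :
    Matrix m n ℤ :=
  fun i j =>
    if i = p ∧ j = q then -B i j
    else if i = p ∨ j = q then B i j
    else B i j - B p q * B i q * B p j

lemma pivotMat_skewBip {m n : Type*} [DecidableEq m] [DecidableEq n] (B : Matrix m n ℤ)
    (p : m) (q : n) : pivotMat (skewBip B) p q = skewBip (bipPivot B p q) := by
  ext i j
  rcases i with i | i <;> rcases j with j | j <;>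
    simp only [pivotMat, skewBip, bipPivot, fromBlocks_apply₁₁, fromBlocks_apply₁₂,
      fromBlocks_apply₂₁, fromBlocks_apply₂₂, Matrix.zero_apply, Matrix.neg_apply, transpose_apply,
      Sum.inl.injEq, Sum.inr.injEq, reduceCtorEq, false_and, and_false, false_or, or_false] <;>
    split_ifs <;> simp_all <;> ring

lemma mem_range_signType_iff (x : ℤ) :
    x ∈ Set.range (SignType.cast : SignType → ℤ) ↔ x ∈ ({-1, 0, 1} : Set ℤ) := by
  constructor
  · rintro ⟨s, rfl⟩
    cases s <;> simp
  · rintro (rfl | rfl | rfl)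
    exacts [⟨-1, rfl⟩, ⟨0, rfl⟩, ⟨1, rfl⟩]

lemma eq_of_mem_signs {x : ℤ} (hx : x ∈ ({-1, 0, 1} : Set ℤ)) : x = -1 ∨ x = 0 ∨ x = 1 := hx

lemma mul_mem_signs {x y : ℤ} (hx : x ∈ ({-1, 0, 1} : Set ℤ)) (hy : y ∈ ({-1, 0, 1} : Set ℤ)) :
    x * y ∈ ({-1, 0, 1} : Set ℤ) := by
  rcases hx with rfl | rfl | rfl <;> rcases hy with rfl | rfl | rfl <;> simp

lemma neg_one_pow_mem_signs (k : ℕ) : (-1 : ℤ) ^ k ∈ ({-1, 0, 1} : Set ℤ) := by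
  rcases neg_one_pow_eq_or ℤ k with h | h <;> simp [h]

lemma mul_self_eq_one_of_mem_signs {x : ℤ} (hx : x ∈ ({-1, 0, 1} : Set ℤ)) (h : x ≠ 0) :
    x * x = 1 := by
  rcases hx with rfl | rfl | rfl <;> simp_all

/-- Schur complement formula for the determinant at a `±1` entry. -/
lemma det_eq_schur {k : ℕ} (N : Matrix (Fin (k + 1)) (Fin (k + 1)) ℤ) (a b : Fin (k + 1))
    (h : N a b * N a b = 1) :
    N.det = (-1) ^ (a + b : ℕ) * N a b *
      (Matrix.of fun i j : Fin k => N (a.succAbove i) (b.succAbove j) -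
        N a b * N (a.succAbove i) b * N a (b.succAbove j)).det := by
  let N' : Matrix (Fin (k + 1)) (Fin (k + 1)) ℤ :=
    Matrix.of fun i j => N i j + (if i = a then 0 else -(N a b * N i b)) * N a j
  have hN : N'.det = N.det :=
    det_eq_of_forall_row_eq_smul_add_const (fun i => if i = a then 0 else -(N a b * N i b)) a
      (by simp) fun i j => rfl
  rw [← hN, det_succ_column N' b, Finset.sum_eq_single a]
  · have h1 : N' a b = N a b := by simp [N']
    rw [h1]
    congr 2
    ext i j
    simp [N', Fin.succAbove_ne]
    ring
  · intro i _ hi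
    have h0 : N' i b = 0 := by
      simp only [N', of_apply, if_neg hi]
      linear_combination (-N i b) * h
    simp [h0]
  · simp

lemma det_submatrix_mem_signs {m n : Type*} {B : Matrix m n ℤ} (hB : B.IsTotallyUnimodular)
    {k : ℕ} (f : Fin k → m) (g : Fin k → n) :
    (B.submatrix f g).det ∈ ({-1, 0, 1} : Set ℤ) :=
  (mem_range_signType_iff _).1 ((isTotallyUnimodular_iff B).1 hB k f g)

section Pivot

variable {m n : Type*} [DecidableEq m] [DecidableEq n]

lemma bipPivot_transpose (B : Matrix m n ℤ) (p : m) (q : n) :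
    (bipPivot B p q)ᵀ = bipPivot Bᵀ q p := by
  ext i j
  simp only [bipPivot, transpose_apply, and_comm, or_comm]
  split_ifs <;> ring

/-- A minor of the pivoted matrix using the pivot row but not the pivot column is unchanged. -/
lemma det_bipPivot_of_row {B : Matrix m n ℤ} {p : m} {q : n} {k : ℕ}
    (f : Fin k → m) (g : Fin k → n) (a : Fin k) (ha : f a = p) (hg : ∀ j, g j ≠ q) :
    ((bipPivot B p q).submatrix f g).det = (B.submatrix f g).det := by
  refine det_eq_of_forall_row_eq_smul_add_const
    (fun i => if f i = p then 0 else -(B p q * B (f i) q)) a (by simp [ha]) fun i j => ?_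
  by_cases hi : f i = p
  · simp [bipPivot, hi, hg]
  · simp [bipPivot, hi, hg, ha]
    ring

lemma isTotallyUnimodular_bipPivot {B : Matrix m n ℤ} (hB : B.IsTotallyUnimodular)
    {p : m} {q : n} (hpq : B p q ≠ 0) : (bipPivot B p q).IsTotallyUnimodular := by
  have hε : B p q ∈ ({-1, 0, 1} : Set ℤ) := (mem_range_signType_iff _).1 (hB.apply p q)
  have hε2 := mul_self_eq_one_of_mem_signs hε hpq
  intro k f g hf hg
  rw [mem_range_signType_iff]
  by_cases hp : ∃ a, f a = p
  · obtain ⟨a, ha⟩ := hp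
    by_cases hq : ∃ b, g b = q
    · obtain ⟨b, hb⟩ := hq
      obtain _ | k := k
      · exact a.elim0
      have hfa : ∀ i, f (a.succAbove i) ≠ p := fun i h =>
        Fin.succAbove_ne a i (hf (h.trans ha.symm))
      have hgb : ∀ j, g (b.succAbove j) ≠ q := fun j h =>
        Fin.succAbove_ne b j (hg (h.trans hb.symm))
      have hN : (bipPivot B p q).submatrix f g a b = -B p q := by simp [bipPivot, ha, hb]
      rw [det_eq_schur _ a b (by rw [hN]; linear_combination hε2), hN]
      refine mul_mem_signs (mul_mem_signs (neg_one_pow_mem_signs _) ?_) ?_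
      · simpa using mul_mem_signs (neg_one_pow_mem_signs 1) hε
      · convert det_submatrix_mem_signs hB (f ∘ a.succAbove) (g ∘ b.succAbove) using 2
        ext i j
        simp [bipPivot, ha, hb, hfa, hgb]
    · push Not at hq
      rw [det_bipPivot_of_row f g a ha hq]
      exact det_submatrix_mem_signs hB f g
  · push Not at hp
    by_cases hq : ∃ b, g b = q
    · obtain ⟨b, hb⟩ := hq
      rw [← det_transpose, transpose_submatrix, bipPivot_transpose,
        det_bipPivot_of_row g f b hb hp]
      exact det_submatrix_mem_signs hB.transpose g f
    · push Not at hq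
      have hS := det_eq_schur (B.submatrix (Fin.cons p f : Fin (k + 1) → m)
        (Fin.cons q g : Fin (k + 1) → n)) 0 0 (by simpa using hε2)
      have hE : ((bipPivot B p q).submatrix f g).det = B p q *
          (B.submatrix (Fin.cons p f : Fin (k + 1) → m)
            (Fin.cons q g : Fin (k + 1) → n)).det := by
        rw [hS]
        simp only [submatrix_apply, Fin.cons_zero, Fin.val_zero, add_zero, pow_zero, one_mul,
          ← mul_assoc, hε2]
        congr 1
        ext i j
        simp [bipPivot, hp, hq]
      rw [hE]
      exact mul_mem_signs hε (det_submatrix_mem_signs hB _ _)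

/-- Total unimodularity follows if all matrices reachable by pivots have entries `0, ±1`. -/
lemma det_mem_signs_of_reachable (k : ℕ) : ∀ (B : Matrix m n ℤ),
    (∀ M, Relation.ReflTransGen PivotStep (skewBip B) M → EntriesUnit M) →
    ∀ (f : Fin k → m) (g : Fin k → n), f.Injective → g.Injective →
      (B.submatrix f g).det ∈ ({-1, 0, 1} : Set ℤ) := by
  induction k with
  | zero => intros; simp
  | succ k ih =>
    intro B hB f g hf hg
    by_cases h0 : ∃ b, B (f 0) (g b) ≠ 0
    · obtain ⟨b, hb⟩ := h0
      have hε : B (f 0) (g b) ∈ ({-1, 0, 1} : Set ℤ) :=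
        hB _ .refl (Sum.inl (f 0)) (Sum.inr (g b))
      rw [det_eq_schur (B.submatrix f g) 0 b (mul_self_eq_one_of_mem_signs hε hb)]
      refine mul_mem_signs (mul_mem_signs (neg_one_pow_mem_signs _) hε) ?_
      have hstep : PivotStep (skewBip B) (skewBip (bipPivot B (f 0) (g b))) :=
        ⟨f 0, g b, hb, (pivotMat_skewBip B _ _).symm⟩
      convert ih (bipPivot B (f 0) (g b)) (fun M hM => hB M (.head hstep hM))
        (f ∘ Fin.succAbove 0) (g ∘ b.succAbove) (hf.comp Fin.succAbove_right_injective)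
        (hg.comp Fin.succAbove_right_injective) using 2
      ext i j
      simp [bipPivot, hf.eq_iff, hg.eq_iff, Fin.succAbove_ne]
    · push Not at h0
      rw [det_eq_zero_of_row_eq_zero 0 (by simpa using h0)]
      simp

lemma exists_isTotallyUnimodular_of_reachable {B : Matrix m n ℤ} (hB : B.IsTotallyUnimodular)
    {M : Matrix (m ⊕ n) (m ⊕ n) ℤ} (hM : Relation.ReflTransGen PivotStep (skewBip B) M) :
    ∃ C : Matrix m n ℤ, C.IsTotallyUnimodular ∧ M = skewBip C := by
  induction hM with
  | refl => exact ⟨B, hB, rfl⟩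
  | tail _ h ih =>
    obtain ⟨C, hC, rfl⟩ := ih
    obtain ⟨p, q, hpq, rfl⟩ := h
    exact ⟨_, isTotallyUnimodular_bipPivot hC hpq, pivotMat_skewBip C p q⟩

end Pivot

lemma det_skewBip_square {l : Type*} [Fintype l] [DecidableEq l] (X : Matrix l l ℤ) :
    (skewBip X).det = X.det ^ 2 := by
  have hJ : (J l ℤ).det = 1 := SymplecticGroup.det_eq_one (SymplecticGroup.J_mem _ _)
  have h : skewBip X * J l ℤ = fromBlocks X 0 0 Xᵀ := by
    simp [skewBip, J, fromBlocks_multiply]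
  have h' := congrArg Matrix.det h
  rw [det_mul, hJ, mul_one, det_fromBlocks_zero₂₁, det_transpose] at h'
  rw [h', sq]

lemma det_skewBip_of_card_ne {m n : Type*} [Fintype m] [Fintype n] [DecidableEq m]
    [DecidableEq n] (X : Matrix m n ℤ) (h : Fintype.card m ≠ Fintype.card n) :
    (skewBip X).det = 0 := by
  rw [det_apply']
  refine Finset.sum_eq_zero fun σ _ => ?_
  by_contra hne
  have hprod : ∀ i, skewBip X (σ i) i ≠ 0 := fun i hi =>
    hne (mul_eq_zero_of_right _ (Finset.prod_eq_zero (Finset.mem_univ i) hi))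
  have h1 : ∀ i : m, ∃ j : n, σ (Sum.inl i) = Sum.inr j := fun i => by
    have := hprod (Sum.inl i)
    rcases hσ : σ (Sum.inl i) with a | b
    · simp [hσ, skewBip] at this
    · exact ⟨b, rfl⟩
  have h2 : ∀ j : n, ∃ i : m, σ (Sum.inr j) = Sum.inl i := fun j => by
    have := hprod (Sum.inr j)
    rcases hσ : σ (Sum.inr j) with a | b
    · exact ⟨a, rfl⟩
    · simp [hσ, skewBip] at this
  choose u hu using h1
  choose v hv using h2
  refine h (le_antisymm (Fintype.card_le_of_injective u fun a b hab => ?_)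
    (Fintype.card_le_of_injective v fun a b hab => ?_))
  · exact Sum.inl_injective (σ.injective (by rw [hu, hu, hab]))
  · exact Sum.inr_injective (σ.injective (by rw [hv, hv, hab]))

lemma det_skewBip_mem {m n : Type*} [Fintype m] [Fintype n] [DecidableEq m] [DecidableEq n]
    {X : Matrix m n ℤ} (hX : X.IsTotallyUnimodular) : (skewBip X).det ∈ ({0, 1} : Set ℤ) := by
  by_cases h : Fintype.card m = Fintype.card n
  · let e : m ≃ n := Fintype.equivOfCardEq h
    have hY : skewBip (X.submatrix id e) =
        (skewBip X).submatrix (Equiv.sumCongr (Equiv.refl m) e)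
          (Equiv.sumCongr (Equiv.refl m) e) := by
      ext (i | i) (j | j) <;> simp [skewBip]
    have hdet : (X.submatrix id e).det ∈ ({-1, 0, 1} : Set ℤ) :=
      (mem_range_signType_iff _).1 ((isTotallyUnimodular_iff_fintype X).1 hX m id e)
    rw [← det_submatrix_equiv_self (Equiv.sumCongr (Equiv.refl m) e), ← hY, det_skewBip_square]
    rcases eq_of_mem_signs hdet with h | h | h <;> simp [h]
  · simp [det_skewBip_of_card_ne X h]

lemma principallyUnimodular_skewBip_iff {m n : Type*} [DecidableEq m] [DecidableEq n]
    (B : Matrix m n ℤ) :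
    (∀ s : Finset (m ⊕ n),
      ((skewBip B).submatrix (Subtype.val : {x // x ∈ s} → (m ⊕ n)) Subtype.val).det
        ∈ ({0, 1} : Set ℤ)) ↔ B.IsTotallyUnimodular := by
  constructor
  · intro h k f g hf hg
    let φ : Fin k ⊕ Fin k ↪ m ⊕ n := ⟨Sum.map f g, hf.sumMap hg⟩
    let e : Fin k ⊕ Fin k ≃ {x // x ∈ Finset.univ.map φ} :=
      Equiv.ofBijective (fun x => ⟨φ x, by simp⟩)
        ⟨fun x y hxy => φ.injective (Subtype.ext_iff.1 hxy), fun ⟨y, hy⟩ => by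
          obtain ⟨x, -, rfl⟩ := Finset.mem_map.1 hy
          exact ⟨x, rfl⟩⟩
    have hE : ((skewBip B).submatrix (Subtype.val : {x // x ∈ Finset.univ.map φ} → (m ⊕ n))
        Subtype.val).submatrix e e = skewBip (B.submatrix f g) := by
      ext (i | i) (j | j) <;> simp [skewBip, e, φ]
    have hs := h (Finset.univ.map φ)
    rw [← det_submatrix_equiv_self e, hE, det_skewBip_square] at hs
    rw [mem_range_signType_iff]
    rcases hs with hs | hs
    · exact Or.inr (Or.inl (pow_eq_zero_iff two_ne_zero |>.1 hs))
    · rcases sq_eq_sq_iff_eq_or_eq_neg.1 (hs.trans (one_pow 2).symm) with h | h <;> simp [h]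
  · intro h s
    let e := (Equiv.subtypeSum (p := fun x : m ⊕ n => x ∈ s)).symm
    let _ : Fintype {a : m // Sum.inl a ∈ s} :=
      Fintype.ofInjective (fun a => (⟨_, a.2⟩ : {x // x ∈ s})) fun a b hab => by
        simpa [Subtype.ext_iff] using hab
    let _ : Fintype {b : n // Sum.inr b ∈ s} :=
      Fintype.ofInjective (fun b => (⟨_, b.2⟩ : {x // x ∈ s})) fun a b hab => by
        simpa [Subtype.ext_iff] using hab
    have hE : ((skewBip B).submatrix (Subtype.val : {x // x ∈ s} → (m ⊕ n))
        Subtype.val).submatrix e e = skewBip (B.submatrix Subtype.val Subtype.val) := by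
      ext (i | i) (j | j) <;> simp [skewBip, e, Equiv.subtypeSum]
    rw [← det_submatrix_equiv_self e, hE]
    exact det_skewBip_mem (h.submatrix _ _)

lemma entriesUnit_skewBip {m n : Type*} {C : Matrix m n ℤ} (hC : C.IsTotallyUnimodular) :
    EntriesUnit (skewBip C) := by
  have h : ∀ i j, C i j ∈ ({-1, 0, 1} : Set ℤ) := fun i j =>
    (mem_range_signType_iff _).1 (hC.apply i j)
  rintro (i | i) (j | j)
  · simp [skewBip]
  · simpa [skewBip] using h i j
  · rcases eq_of_mem_signs (h j i) with h | h | h <;> simp [skewBip, h]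
  · simp [skewBip]

lemma not_hasOddSquare_skewBip {m n : Type*} {C : Matrix m n ℤ} (hC : C.IsTotallyUnimodular) :
    ¬ HasOddSquare (skewBip C) := by
  rintro ⟨i, p, j, q, -, -, -, -, -, -, h⟩
  have hdet := det_submatrix_mem_signs hC ![i, p] ![j, q]
  have hu : ∀ i j, C i j = -1 ∨ C i j = 0 ∨ C i j = 1 := fun i j =>
    eq_of_mem_signs ((mem_range_signType_iff _).1 (hC.apply i j))
  simp only [skewBip, fromBlocks_apply₁₂] at h
  simp only [det_fin_two, submatrix_apply, cons_val_zero, cons_val_one] at hdet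
  rcases hu i j with h1 | h1 | h1 <;> rcases hu i q with h2 | h2 | h2 <;>
    rcases hu p j with h3 | h3 | h3 <;> rcases hu p q with h4 | h4 | h4 <;>
    simp [h1, h2, h3, h4] at h hdet

/-- a bipartite skew-symmetric `±1/0` matrix is principally unimodular
iff every matrix reachable from it by a finite sequence of Ω₄-pivots has entries in
`{-1, 0, 1}` and contains no odd square. -/
theorem stmt8 [Fintype V₀] [Fintype V₁] [DecidableEq V₀] [DecidableEq V₁]
    (A : Matrix (V₀ ⊕ V₁) (V₀ ⊕ V₁) ℤ) (hskew : Aᵀ = -A)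
    (hent : EntriesUnit A)
    (hbip₀ : ∀ i j : V₀, A (Sum.inl i) (Sum.inl j) = 0)
    (hbip₁ : ∀ i j : V₁, A (Sum.inr i) (Sum.inr j) = 0) :
    (∀ s : Finset (V₀ ⊕ V₁),
        (A.submatrix (Subtype.val : {x // x ∈ s} → (V₀ ⊕ V₁)) Subtype.val).det
          ∈ ({0, 1} : Set ℤ)) ↔
      (∀ M, Relation.ReflTransGen PivotStep A M → EntriesUnit M ∧ ¬ HasOddSquare M) := by
  obtain ⟨B, rfl⟩ : ∃ B : Matrix V₀ V₁ ℤ, A = skewBip B := by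
    refine ⟨A.toBlocks₁₂, ?_⟩
    ext (i | i) (j | j)
    · simp [skewBip, hbip₀]
    · simp [skewBip, toBlocks₁₂]
    · have := congrFun (congrFun hskew (Sum.inr i)) (Sum.inl j)
      simp only [transpose_apply, Matrix.neg_apply] at this
      simp [skewBip, toBlocks₁₂, this]
    · simp [skewBip, hbip₁]
  rw [principallyUnimodular_skewBip_iff]
  constructor
  · intro hB M hM
    obtain ⟨C, hC, rfl⟩ := exists_isTotallyUnimodular_of_reachable hB hM
    exact ⟨entriesUnit_skewBip hC, not_hasOddSquare_skewBip hC⟩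
  · intro h k f g hf hg
    exact (mem_range_signType_iff _).2
      (det_mem_signs_of_reachable k B (fun M hM => (h M hM).1) f g hf hg)
end

section
/- Let V = V₀ ⊔ V₁ be a finite set, A a principally unimodular skew-symmetric integer matrix on V with entries in {−1, 0, 1} vanishing on V₀ × V₀ and V₁ × V₁, and sgn : V → {−1, 1} a labeling. Then for every state s ⊆ V and every i ∈ V with (i ∉ s if sgn(i) = −1, and i ∈ s if sgn(i) = 1): e_i lies in the ℤ-span of the rows of R(s) if and only if e_i does NOT lie in the ℤ-span of the rows of R(s ⊕ i). (That is, x_i = 0 in V(s) iff x_i ≠ 0 in V(s ⊕ i).) -/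
open Matrix

/-- The relation matrix `R(s)` of a state `s`:
`R(s)_{v,w} = (1 if v = w ∧ v ∉ s) - (sgn w · A v w if w ∈ s)`. -/
def relMat {V : Type*} [DecidableEq V] (A : Matrix V V ℤ) (sgn : V → ℤ) (s : Finset V) :
    Matrix V V ℤ :=
  fun v w => (if v = w ∧ v ∉ s then 1 else 0) - (if w ∈ s then sgn w * A v w else 0)

/-- `s ⊕ i`: toggle membership of `i` in `s`. -/
def stoggle {V : Type*} [DecidableEq V] (s : Finset V) (i : V) : Finset V :=
  if i ∈ s then s.erase i else insert i s

theorem vecMul_dotProduct_swap {V : Type*} [Fintype V] {A : Matrix V V ℤ} (hA : Aᵀ = -A)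
    (y z : V → ℤ) :
    (y ᵥ* A) ⬝ᵥ z = -((z ᵥ* A) ⬝ᵥ y) := by
  rw [← dotProduct_mulVec, ← vecMul_transpose, hA, vecMul_neg, dotProduct_neg, dotProduct_comm]

theorem transpose_submatrix_of_transpose_eq_neg {V α β : Type*} {A : Matrix V V ℤ}
    (hA : Aᵀ = -A) (g : α → V) (h : β → V) : (A.submatrix g h)ᵀ = -A.submatrix h g := by
  rw [transpose_submatrix, hA, submatrix_neg]
  rfl

section

variable {V : Type*} [DecidableEq V]

/-- The `(u, w)` entry of the Schur complement of the principal submatrix `A(X)` in `A`. -/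
noncomputable def schurEntry (A : Matrix V V ℤ) (X : Finset V) (u w : V) : ℤ :=
  A u w - ((fun x : {x // x ∈ X} => A u x) ᵥ*
    (A.submatrix (Subtype.val : {x // x ∈ X} → V) Subtype.val)⁻¹) ⬝ᵥ
      (fun x : {x // x ∈ X} => A x w)

theorem schurEntry_eq_zero {A : Matrix V V ℤ} {X : Finset V}
    (hX : (A.submatrix (Subtype.val : {x // x ∈ X} → V) Subtype.val).det = 1)
    (u : V) {w : V} (hw : w ∈ X) : schurEntry A X u w = 0 := by
  set M := A.submatrix (Subtype.val : {x // x ∈ X} → V) Subtype.val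
  have hu : IsUnit M.det := by rw [hX]; exact isUnit_one
  have h : (((fun x : {x // x ∈ X} => A u x) ᵥ* M⁻¹) ᵥ* M) ⟨w, hw⟩ = A u w := by
    rw [vecMul_vecMul, nonsing_inv_mul _ hu, vecMul_one]
  unfold schurEntry
  rw [sub_eq_zero, ← h]
  rfl

theorem exists_vecMul_eq_schurEntry [Fintype V] (A : Matrix V V ℤ) (X : Finset V) {u : V}
    (hu : u ∉ X) :
    ∃ y : V → ℤ, y u = 1 ∧ (∀ v, v ∉ X → v ≠ u → y v = 0) ∧
      ∀ w, (y ᵥ* A) w = schurEntry A X u w := by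
  set r : {x // x ∈ X} → ℤ := (fun x : {x // x ∈ X} => A u x) ᵥ*
    (A.submatrix (Subtype.val : {x // x ∈ X} → V) (Subtype.val : {x // x ∈ X} → V))⁻¹ with hr
  let z : V → ℤ := fun v => if h : v ∈ X then r ⟨v, h⟩ else 0
  refine ⟨Pi.single u 1 - z, by simp [z, hu], fun v hv hvu => by simp [z, hv, hvu], fun w => ?_⟩
  rw [sub_vecMul, Pi.sub_apply, single_one_vecMul, schurEntry, ← hr]
  congr 1
  have h1 : (z ᵥ* A) w = ∑ v ∈ X, z v * A v w :=
    (Finset.sum_subset (Finset.subset_univ X) fun v _ hv => by simp [z, hv]).symm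
  rw [h1, ← Finset.sum_coe_sort]
  exact Finset.sum_congr rfl fun v _ => by simp [z]

theorem det_submatrix_eq_det_image {α : Type*} [Fintype α] [DecidableEq α] (A : Matrix V V ℤ)
    {f : α → V} (hf : Function.Injective f) :
    (A.submatrix f f).det = (A.submatrix
      (Subtype.val : {x // x ∈ Finset.univ.image f} → V) Subtype.val).det := by
  let e : α ≃ {x // x ∈ Finset.univ.image f} :=
    Equiv.ofBijective (fun a => ⟨f a, Finset.mem_image_of_mem f (Finset.mem_univ a)⟩)
      ⟨fun a b h => hf (congrArg Subtype.val h), fun ⟨x, hx⟩ => by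
        obtain ⟨a, -, rfl⟩ := Finset.mem_image.1 hx
        exact ⟨a, rfl⟩⟩
  rw [← det_submatrix_equiv_self e]
  rfl

theorem det_insert_insert_eq_schurEntry_sq {A : Matrix V V ℤ} (hA : Aᵀ = -A) {X : Finset V}
    (hX : (A.submatrix (Subtype.val : {x // x ∈ X} → V) Subtype.val).det = 1)
    {u w : V} (hu : u ∉ X) (hw : w ∉ X) (huw : u ≠ w) :
    (A.submatrix (Subtype.val : {x // x ∈ insert u (insert w X)} → V) Subtype.val).det =
      schurEntry A X u w ^ 2 := by
  let f : {x // x ∈ X} ⊕ Fin 2 → V := Sum.elim Subtype.val ![u, w]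
  have hf : Function.Injective f := by
    refine Subtype.val_injective.sumElim ?_ ?_
    · intro a b h
      fin_cases a <;> fin_cases b <;> simp_all [Ne.symm]
    · rintro ⟨x, hx⟩ b rfl
      fin_cases b <;> simp_all
  have himg : insert u (insert w X) = Finset.univ.image f := by
    ext x
    simp [f, Fin.exists_fin_two]
    grind
  set M := A.submatrix (Subtype.val : {x // x ∈ X} → V) Subtype.val
  have : Invertible M := invertibleOfIsUnitDet M (by rw [hX]; exact isUnit_one)
  set B : Matrix {x // x ∈ X} (Fin 2) ℤ := A.submatrix Subtype.val ![u, w]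
  set C : Matrix (Fin 2) {x // x ∈ X} ℤ := A.submatrix ![u, w] Subtype.val
  set D : Matrix (Fin 2) (Fin 2) ℤ := A.submatrix ![u, w] ![u, w]
  have hblocks : A.submatrix f f = fromBlocks M B C D := by
    ext (a | a) (b | b) <;> rfl
  rw [himg, ← det_submatrix_eq_det_image A hf, hblocks, det_fromBlocks₁₁, hX, one_mul,
    invOf_eq_nonsing_inv]
  set S : Matrix (Fin 2) (Fin 2) ℤ := D - C * M⁻¹ * B with hS
  have hMT : Mᵀ = -M := transpose_submatrix_of_transpose_eq_neg hA _ _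
  have hBT : Bᵀ = -C := transpose_submatrix_of_transpose_eq_neg hA _ _
  have hCT : Cᵀ = -B := transpose_submatrix_of_transpose_eq_neg hA _ _
  have hDT : Dᵀ = -D := transpose_submatrix_of_transpose_eq_neg hA _ _
  have hMinv : M⁻¹ᵀ = -M⁻¹ := by
    rw [transpose_nonsing_inv, hMT]
    refine inv_eq_left_inv ?_
    rw [neg_mul_neg, nonsing_inv_mul _ (by rw [hX]; exact isUnit_one)]
  have hskew : Sᵀ = -S := by
    rw [hS, transpose_sub, transpose_mul, transpose_mul, hMinv, hBT, hCT, hDT]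
    simp only [Matrix.neg_mul, Matrix.mul_neg, neg_neg, Matrix.mul_assoc]
    abel
  have hentry (a b : Fin 2) : S b a = -S a b := congrFun (congrFun hskew a) b
  have h01 : S 0 1 = schurEntry A X u w := rfl
  have h00 : S 0 0 = 0 := by have := hentry 0 0; omega
  rw [det_fin_two, h00, hentry 0 1, h01]
  ring

theorem single_mem_span_relMat_iff [Fintype V] {A : Matrix V V ℤ} {sgn : V → ℤ} {s : Finset V}
    {i : V} :
    Pi.single i (1 : ℤ) ∈ Submodule.span ℤ (Set.range (relMat A sgn s)) ↔
      ∃ y : V → ℤ, (∀ w, w ∉ s → y w = Pi.single (M := fun _ => ℤ) i 1 w) ∧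
        ∀ w, w ∈ s → -(sgn w * (y ᵥ* A) w) = Pi.single (M := fun _ => ℤ) i 1 w := by
  refine (Submodule.mem_span_range_iff_exists_fun ℤ).trans ?_
  refine exists_congr fun y => ?_
  have h (w : V) : (∑ v, y v • relMat A sgn s v) w =
      if w ∈ s then -(sgn w * (y ᵥ* A) w) else y w := by
    rw [Finset.sum_apply]
    split_ifs with hw
    · simp only [vecMul, dotProduct, Finset.mul_sum, ← Finset.sum_neg_distrib]
      refine Finset.sum_congr rfl fun v _ => ?_
      have : ¬(v = w ∧ v ∉ s) := by rintro ⟨rfl, h⟩; exact h hw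
      simp only [Pi.smul_apply, relMat, if_neg this, if_pos hw, smul_eq_mul]
      ring
    · rw [Finset.sum_eq_single w]
      · simp [relMat, hw]
      · intro v _ hv
        simp [relMat, hw, hv]
      · simp
  rw [funext_iff]
  simp only [h]
  constructor
  · intro H
    exact ⟨fun w hw => by simpa [hw] using H w, fun w hw => by simpa [hw] using H w⟩
  · rintro ⟨H₁, H₂⟩ w
    split_ifs with hw
    exacts [H₂ w hw, H₁ w hw]

theorem single_notMem_span_relMat_insert [Fintype V] {A : Matrix V V ℤ} (hA : Aᵀ = -A)
    {sgn : V → ℤ} (hsgn : ∀ v, sgn v = 1 ∨ sgn v = -1) {t : Finset V} {i : V} (hi : i ∉ t)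
    (h : Pi.single i (1 : ℤ) ∈ Submodule.span ℤ (Set.range (relMat A sgn t))) :
    Pi.single i (1 : ℤ) ∉ Submodule.span ℤ (Set.range (relMat A sgn (insert i t))) := by
  rw [single_mem_span_relMat_iff] at h ⊢
  rintro ⟨z, hz₁, hz₂⟩
  obtain ⟨y, hy₁, hy₂⟩ := h
  have hyt : ∀ w ∈ t, (y ᵥ* A) w = 0 := fun w hw => by
    have h := hy₂ w hw
    have hwi : w ≠ i := by rintro rfl; exact hi hw
    rcases hsgn w with hs | hs <;> simpa [hs, hwi] using h
  have hyi : y i = 1 := by simpa using hy₁ i hi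
  have hzt : ∀ w ∈ t, (z ᵥ* A) w = 0 := fun w hw => by
    have h := hz₂ w (Finset.mem_insert_of_mem hw)
    have hwi : w ≠ i := by rintro rfl; exact hi hw
    rcases hsgn w with hs | hs <;> simpa [hs, hwi] using h
  have hzi : (z ᵥ* A) i ≠ 0 := fun h0 => by
    simpa [h0] using hz₂ i (Finset.mem_insert_self i t)
  have hdot {a b : V → ℤ} (ha : ∀ w ∈ t, (a ᵥ* A) w = 0)
      (hb : ∀ w, w ∉ insert i t → b w = 0) : (a ᵥ* A) ⬝ᵥ b = (a ᵥ* A) i * b i := by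
    refine Finset.sum_eq_single i (fun w _ hwi => ?_) (by simp)
    by_cases hw : w ∈ t
    · rw [ha w hw, zero_mul]
    · rw [hb w (by simp [hw, hwi]), mul_zero]
  have hy0 : ∀ w, w ∉ insert i t → y w = 0 := fun w hw => by
    rw [Finset.mem_insert, not_or] at hw
    simpa [hw.1] using hy₁ w hw.2
  have hz0 : ∀ w, w ∉ insert i t → z w = 0 := fun w hw => by
    have h := hz₁ w hw
    rw [Finset.mem_insert, not_or] at hw
    simpa [hw.1] using h
  have hyy := vecMul_dotProduct_swap hA y y
  rw [hdot hyt hy0, hyi] at hyy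
  have hzy := vecMul_dotProduct_swap hA z y
  rw [hdot hzt hy0, hdot hyt hz0, hyi] at hzy
  have hyAi : (y ᵥ* A) i = 0 := by omega
  rw [hyAi] at hzy
  exact hzi (by simpa using hzy)

theorem single_mem_span_relMat_or_insert [Fintype V] {A : Matrix V V ℤ} (hA : Aᵀ = -A)
    (hPU : ∀ s : Finset V,
      (A.submatrix (Subtype.val : {x // x ∈ s} → V) Subtype.val).det ∈ ({0, 1} : Set ℤ))
    {sgn : V → ℤ} (hsgn : ∀ v, sgn v = 1 ∨ sgn v = -1) {t : Finset V} {i : V} (hi : i ∉ t) :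
    Pi.single i (1 : ℤ) ∈ Submodule.span ℤ (Set.range (relMat A sgn t)) ∨
      Pi.single i (1 : ℤ) ∈ Submodule.span ℤ (Set.range (relMat A sgn (insert i t))) := by
  obtain ⟨X, hXmem, hXmax⟩ := Finset.exists_max_image
    (t.powerset.filter fun X =>
      (A.submatrix (Subtype.val : {x // x ∈ X} → V) Subtype.val).det = 1) Finset.card
    ⟨∅, by simp⟩
  rw [Finset.mem_filter, Finset.mem_powerset] at hXmem
  obtain ⟨hXt, hX⟩ := hXmem
  have hiX : i ∉ X := fun h => hi (hXt h)
  have hrange {u w : V} (hu : u ∉ X) (hw : w ∉ X) (huw : u ≠ w) :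
      schurEntry A X u w ^ 2 = 0 ∨ schurEntry A X u w ^ 2 = 1 := by
    rw [← det_insert_insert_eq_schurEntry_sq hA hX hu hw huw]
    exact hPU _
  have hself (u : V) (hu : u ∉ X) : schurEntry A X u u = 0 := by
    obtain ⟨y, hy, hy0, hyA⟩ := exists_vecMul_eq_schurEntry A X hu
    have hyy := vecMul_dotProduct_swap hA y y
    have : (y ᵥ* A) ⬝ᵥ y = (y ᵥ* A) u * y u := by
      refine Finset.sum_eq_single u (fun w _ hwu => ?_) (by simp)
      by_cases hw : w ∈ X
      · rw [hyA, schurEntry_eq_zero hX u hw, zero_mul]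
      · rw [hy0 w hw hwu, mul_zero]
    rw [this, hy, hyA] at hyy
    omega
  have hzero {u w : V} (hu : u ∈ t) (huX : u ∉ X) (hw : w ∈ t) : schurEntry A X u w = 0 := by
    by_cases hwX : w ∈ X
    · exact schurEntry_eq_zero hX u hwX
    by_cases huw : u = w
    · exact huw ▸ hself u huX
    rcases hrange huX hwX huw with h | h
    · exact pow_eq_zero_iff two_ne_zero |>.1 h
    · rw [← det_insert_insert_eq_schurEntry_sq hA hX huX hwX huw] at h
      have hcard := hXmax (insert u (insert w X)) (by
        rw [Finset.mem_filter, Finset.mem_powerset]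
        exact ⟨Finset.insert_subset hu (Finset.insert_subset hw hXt), h⟩)
      rw [Finset.card_insert_of_notMem (by simp [huw, huX]),
        Finset.card_insert_of_notMem hwX] at hcard
      omega
  by_cases hex : ∃ u ∈ t, u ∉ X ∧ schurEntry A X u i ≠ 0
  · right
    obtain ⟨u, hu, huX, hne⟩ := hex
    have hui : u ≠ i := by rintro rfl; exact hi hu
    obtain ⟨y, -, hy0, hyA⟩ := exists_vecMul_eq_schurEntry A X huX
    have hsq : schurEntry A X u i ^ 2 = 1 :=
      (hrange huX hiX hui).resolve_left (pow_ne_zero 2 hne)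
    rw [single_mem_span_relMat_iff]
    refine ⟨(-(sgn i * schurEntry A X u i)) • y, fun w hw => ?_, fun w hw => ?_⟩
    · rw [Finset.mem_insert, not_or] at hw
      have hwu : w ≠ u := by rintro rfl; exact hw.2 hu
      simp [hw.1, hy0 w (fun h => hw.2 (hXt h)) hwu]
    · rw [smul_vecMul, Pi.smul_apply, hyA, smul_eq_mul]
      rcases Finset.mem_insert.1 hw with rfl | hw
      · have hs : sgn w ^ 2 = 1 := by rcases hsgn w with h | h <;> simp [h]
        rw [Pi.single_eq_same]
        linear_combination schurEntry A X u w ^ 2 * hs + hsq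
      · have hwi : w ≠ i := fun h => hi (h ▸ hw)
        simp [hzero hu huX hw, hwi]
  · left
    push Not at hex
    obtain ⟨y, hy, hy0, hyA⟩ := exists_vecMul_eq_schurEntry A X hiX
    rw [single_mem_span_relMat_iff]
    refine ⟨y, fun w hw => ?_, fun w hw => ?_⟩
    · by_cases hwi : w = i
      · subst hwi
        simpa using hy
      · simpa [hwi] using hy0 w (fun h => hw (hXt h)) hwi
    · have hwi : w ≠ i := by rintro rfl; exact hi hw
      have h0 : schurEntry A X i w = 0 := by
        by_cases hwX : w ∈ X
        · exact schurEntry_eq_zero hX i hwX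
        · have h := det_insert_insert_eq_schurEntry_sq hA hX hwX hiX hwi
          rw [hex w hw hwX, Finset.insert_comm,
            det_insert_insert_eq_schurEntry_sq hA hX hiX hwX hwi.symm] at h
          simpa using h
      simp [hyA, h0, hwi]

end

/-- for `i` as dictated by the sign (`i ∉ s` if `sgn i = -1`, `i ∈ s` if
`sgn i = 1`), `x_i = 0` in `V(s)` iff `x_i ≠ 0` in `V(s ⊕ i)` (with `x_i = 0` in `V(s)`
meaning that `e_i` lies in the `ℤ`-span of the rows of `R(s)`). -/
theorem stmt13 {V₀ V₁ : Type*} [Fintype V₀] [Fintype V₁] [DecidableEq V₀] [DecidableEq V₁]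
    (A : Matrix (V₀ ⊕ V₁) (V₀ ⊕ V₁) ℤ) (hskew : Aᵀ = -A)
    (hent : ∀ i j, A i j ∈ ({-1, 0, 1} : Set ℤ))
    (hbip₀ : ∀ i j : V₀, A (Sum.inl i) (Sum.inl j) = 0)
    (hbip₁ : ∀ i j : V₁, A (Sum.inr i) (Sum.inr j) = 0)
    (hPU : ∀ s : Finset (V₀ ⊕ V₁),
      (A.submatrix (Subtype.val : {x // x ∈ s} → (V₀ ⊕ V₁)) Subtype.val).det
        ∈ ({0, 1} : Set ℤ))
    (sgn : V₀ ⊕ V₁ → ℤ) (hsgn : ∀ v, sgn v = 1 ∨ sgn v = -1)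
    (s : Finset (V₀ ⊕ V₁)) (i : V₀ ⊕ V₁)
    (hneg : sgn i = -1 → i ∉ s) (hpos : sgn i = 1 → i ∈ s) :
    Pi.single i (1 : ℤ) ∈ Submodule.span ℤ (Set.range (relMat A sgn s)) ↔
      Pi.single i (1 : ℤ) ∉ Submodule.span ℤ (Set.range (relMat A sgn (stoggle s i))) := by
  have key {t : Finset (V₀ ⊕ V₁)} (hi : i ∉ t) :
      Pi.single i (1 : ℤ) ∈ Submodule.span ℤ (Set.range (relMat A sgn t)) ↔
        Pi.single i (1 : ℤ) ∉ Submodule.span ℤ (Set.range (relMat A sgn (insert i t))) :=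
    ⟨single_notMem_span_relMat_insert hskew hsgn hi,
      (single_mem_span_relMat_or_insert hskew hPU hsgn hi).resolve_right⟩
  by_cases his : i ∈ s
  · have h := key (Finset.notMem_erase i s)
    rw [Finset.insert_erase his] at h
    rw [stoggle, if_pos his, h, not_not]
  · rw [stoggle, if_neg his]
    exact key his
end
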